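/- Let V be a real vector space of dimension 2m (with m ≥ 1) and let ω be a nondegenerate alternating bilinear form on V, regarded as an element of Λ²V*. Then for every integer k with 0 ≤ k ≤ m-1, the linear map ε(ω) : Λ^k V* → Λ^{k+2} V* given by exterior multiplication α ↦ ω ∧ α is injective. -/

import Mathlib

/-!
STATEMENT 0: Let `V` be a real vector space of dimension `2m` (with `m ≥ 1`) and let `ω` be a
nondegenerate alternating bilinear form on `V`, regarded as an element `Ω` of `Λ²V*`.
Then for every integer `k` with `0 ≤ k ≤ m-1`, the linear map `ε(ω) : Λ^k V* → Λ^{k+2} V*`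
given by exterior multiplication `α ↦ ω ∧ α` is injective.

Here `Λ^k V*` is realized as the `k`-th exterior power `⋀[ℝ]^k (Module.Dual ℝ V)` inside the
exterior algebra of the dual space, exterior multiplication is multiplication in the exterior
algebra, and the correspondence between the element `Ω ∈ Λ²V*` and the bilinear form `ω` is
expressed by evaluating `Ω` against pairs of vectors of `V`.
-/

/-- The alternating `2`-form `(φ, ψ) ↦ φ(v)ψ(w) - ψ(v)φ(w)` on the dual space, used to
evaluate elements of `Λ² V*` against a pair of vectors `v, w ∈ V`. -/
noncomputable def evalPair {V : Type*} [AddCommGroup V] [Module ℝ V] (v w : V) :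
    (Module.Dual ℝ V) [⋀^Fin 2]→ₗ[ℝ] ℝ :=
  MultilinearMap.alternatization
    ((MultilinearMap.mkPiAlgebra ℝ (Fin 2) ℝ).compLinearMap
      ![Module.Dual.eval ℝ V v, Module.Dual.eval ℝ V w])

/-- Evaluation of an element of the exterior algebra of `V*` (thought of in degree `2`) against
a pair of vectors `v, w ∈ V`; this realizes an element of `Λ² V*` as a bilinear form on `V`. -/
noncomputable def asBilinForm {V : Type*} [AddCommGroup V] [Module ℝ V]
    (Ω : ExteriorAlgebra ℝ (Module.Dual ℝ V)) (v w : V) : ℝ :=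
  ExteriorAlgebra.liftAlternating
    (fun i => match i with
      | 2 => evalPair v w
      | _ => 0) Ω

/-- Contraction of a form by a vector `v`. -/
noncomputable def cont {V : Type*} [AddCommGroup V] [Module ℝ V] (v : V) :
    ExteriorAlgebra ℝ (Module.Dual ℝ V) →ₗ[ℝ] ExteriorAlgebra ℝ (Module.Dual ℝ V) :=
  CliffordAlgebra.contractLeft (Q := (0 : QuadraticForm ℝ (Module.Dual ℝ V)))
    (Module.Dual.eval ℝ V v)

section helpers

variable {V : Type*} [AddCommGroup V] [Module ℝ V]

theorem cont_ι_mul (v : V) (a : Module.Dual ℝ V) (x : ExteriorAlgebra ℝ (Module.Dual ℝ V)) :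
    cont v (ExteriorAlgebra.ι ℝ a * x) = a v • x - ExteriorAlgebra.ι ℝ a * cont v x :=
  CliffordAlgebra.contractLeft_ι_mul _ _ _

theorem cont_algebraMap (v : V) (r : ℝ) :
    cont v (algebraMap ℝ (ExteriorAlgebra ℝ (Module.Dual ℝ V)) r) = 0 :=
  CliffordAlgebra.contractLeft_algebraMap _ _ _

theorem cont_ι (v : V) (a : Module.Dual ℝ V) :
    cont v (ExteriorAlgebra.ι ℝ a) = algebraMap ℝ _ (a v) :=
  CliffordAlgebra.contractLeft_ι _ _ _

theorem power_induction {k : ℕ} {p : ExteriorAlgebra ℝ (Module.Dual ℝ V) → Prop}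
    (hmul : ∀ (a : Module.Dual ℝ V), ∀ y ∈ ⋀[ℝ]^k (Module.Dual ℝ V),
      p (ExteriorAlgebra.ι ℝ a * y))
    (hadd : ∀ x y, p x → p y → p (x + y)) {x : ExteriorAlgebra ℝ (Module.Dual ℝ V)}
    (hx : x ∈ ⋀[ℝ]^(k + 1) (Module.Dual ℝ V)) : p x := by
  rw [ExteriorAlgebra.exteriorPower, pow_succ'] at hx
  refine Submodule.mul_induction_on hx ?_ hadd
  rintro _ ⟨a, rfl⟩ y hy
  exact hmul a y hy

theorem ι_mul_mem {k : ℕ} (a : Module.Dual ℝ V) {y : ExteriorAlgebra ℝ (Module.Dual ℝ V)}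
    (hy : y ∈ ⋀[ℝ]^k (Module.Dual ℝ V)) :
    ExteriorAlgebra.ι ℝ a * y ∈ ⋀[ℝ]^(k + 1) (Module.Dual ℝ V) := by
  rw [ExteriorAlgebra.exteriorPower, pow_succ']
  exact Submodule.mul_mem_mul ⟨a, rfl⟩ hy

theorem mem_power_zero {x : ExteriorAlgebra ℝ (Module.Dual ℝ V)}
    (hx : x ∈ ⋀[ℝ]^0 (Module.Dual ℝ V)) : ∃ r, x = algebraMap ℝ _ r := by
  rw [ExteriorAlgebra.exteriorPower, pow_zero] at hx
  obtain ⟨r, hr⟩ := Submodule.mem_one.1 hx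
  exact ⟨r, hr.symm⟩

theorem cont_zero {x : ExteriorAlgebra ℝ (Module.Dual ℝ V)}
    (hx : x ∈ ⋀[ℝ]^0 (Module.Dual ℝ V)) (v : V) : cont v x = 0 := by
  obtain ⟨r, rfl⟩ := mem_power_zero hx
  exact cont_algebraMap v r

theorem cont_mem (v : V) (k : ℕ) : ∀ x ∈ ⋀[ℝ]^(k + 1) (Module.Dual ℝ V),
    cont v x ∈ ⋀[ℝ]^k (Module.Dual ℝ V) := by
  induction k with
  | zero =>
    intro x hx
    refine power_induction (k := 0)
      (p := fun x => cont v x ∈ ⋀[ℝ]^0 (Module.Dual ℝ V)) ?_ ?_ hx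
    · intro a y hy
      rw [cont_ι_mul, cont_zero hy, mul_zero, sub_zero]
      exact Submodule.smul_mem _ _ hy
    · intro x y hx hy
      rw [map_add]
      exact Submodule.add_mem _ hx hy
  | succ k ih =>
    intro x hx
    refine power_induction (k := k + 1)
      (p := fun x => cont v x ∈ ⋀[ℝ]^(k + 1) (Module.Dual ℝ V)) ?_ ?_ hx
    · intro a y hy
      rw [cont_ι_mul]
      exact Submodule.sub_mem _ (Submodule.smul_mem _ _ hy) (ι_mul_mem a (ih y hy))
    · intro x y hx hy
      rw [map_add]
      exact Submodule.add_mem _ hx hy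

/-- The Euler (degree) operator. -/
theorem euler {I : Type*} [Fintype I] (ψ : I → Module.Dual ℝ V) (u : I → V)
    (h : ∀ a : Module.Dual ℝ V, ∑ i, a (u i) • ψ i = a) (k : ℕ) :
    ∀ x ∈ ⋀[ℝ]^k (Module.Dual ℝ V),
      ∑ i, ExteriorAlgebra.ι ℝ (ψ i) * cont (u i) x = (k : ℝ) • x := by
  induction k with
  | zero =>
    intro x hx
    simp [cont_zero hx]
  | succ k ih =>
    intro x hx
    refine power_induction (k := k) (p := fun x =>
      ∑ i, ExteriorAlgebra.ι ℝ (ψ i) * cont (u i) x = ((k + 1 : ℕ) : ℝ) • x) ?_ ?_ hx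
    · intro a y hy
      have h1 : ∀ i, ExteriorAlgebra.ι ℝ (ψ i) * cont (u i) (ExteriorAlgebra.ι ℝ a * y) =
          ExteriorAlgebra.ι ℝ (a (u i) • ψ i) * y +
          ExteriorAlgebra.ι ℝ a * (ExteriorAlgebra.ι ℝ (ψ i) * cont (u i) y) := by
        intro i
        have h2 := ExteriorAlgebra.ι_add_mul_swap (R := ℝ) (ψ i) a
        have h3 : ExteriorAlgebra.ι ℝ (ψ i) * ExteriorAlgebra.ι ℝ a =
          - (ExteriorAlgebra.ι ℝ a * ExteriorAlgebra.ι ℝ (ψ i)) := eq_neg_of_add_eq_zero_left h2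
        rw [cont_ι_mul, mul_sub, ← mul_assoc _ _ (cont (u i) y), h3, map_smul, mul_smul_comm,
          smul_mul_assoc, neg_mul, sub_neg_eq_add, mul_assoc]
      simp_rw [h1]
      rw [Finset.sum_add_distrib, ← Finset.sum_mul, ← map_sum, h, ← Finset.mul_sum, ih y hy,
        mul_smul_comm]
      push_cast
      rw [add_smul, one_smul, add_comm]
    · intro x y hx hy
      simp only [map_add, mul_add, Finset.sum_add_distrib, hx, hy, smul_add]

theorem cont_two_mul (v : V) {Ω : ExteriorAlgebra ℝ (Module.Dual ℝ V)}
    (hΩ : Ω ∈ ⋀[ℝ]^2 (Module.Dual ℝ V)) (x : ExteriorAlgebra ℝ (Module.Dual ℝ V)) :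
    cont v (Ω * x) = cont v Ω * x + Ω * cont v x := by
  refine power_induction (k := 1) (p := fun Ω =>
    cont v (Ω * x) = cont v Ω * x + Ω * cont v x) ?_ ?_ hΩ
  · intro a y hy
    refine power_induction (k := 0) (p := fun y =>
      cont v (ExteriorAlgebra.ι ℝ a * y * x) = cont v (ExteriorAlgebra.ι ℝ a * y) * x +
        ExteriorAlgebra.ι ℝ a * y * cont v x) ?_ ?_ hy
    · intro b z hz
      obtain ⟨r, rfl⟩ := mem_power_zero hz
      rw [← Algebra.commutes, ← Algebra.smul_def]
      simp only [mul_smul_comm, smul_mul_assoc, map_smul, mul_assoc, cont_ι_mul, cont_ι, mul_sub,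
        sub_mul, ← Algebra.commutes (R := ℝ), ← Algebra.smul_def]
      module
    · intro y z hy hz
      simp only [mul_add, add_mul, map_add, hy, hz]
      abel
  · intro y z hy hz
    simp only [mul_add, add_mul, map_add, hy, hz]
    abel

theorem asBilinForm_add (x y : ExteriorAlgebra ℝ (Module.Dual ℝ V)) (v w : V) :
    asBilinForm (x + y) v w = asBilinForm x v w + asBilinForm y v w := by
  simp only [asBilinForm, map_add]

theorem asBilinForm_smul (r : ℝ) (x : ExteriorAlgebra ℝ (Module.Dual ℝ V)) (v w : V) :
    asBilinForm (r • x) v w = r * asBilinForm x v w := by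
  simp only [asBilinForm, map_smul, smul_eq_mul]

theorem asBilinForm_ι_ι (a b : Module.Dual ℝ V) (v w : V) :
    asBilinForm (ExteriorAlgebra.ι ℝ a * ExteriorAlgebra.ι ℝ b) v w = a v * b w - b v * a w := by
  rw [asBilinForm, ExteriorAlgebra.liftAlternating_ι_mul, ExteriorAlgebra.liftAlternating_ι]
  change evalPair v w ![a, b] = _
  rw [evalPair, MultilinearMap.alternatization_apply]
  rw [Fintype.sum_equiv (Equiv.Perm.decomposeFin (n := 1)) _
    (fun p => Equiv.Perm.sign (Equiv.Perm.decomposeFin.symm p) •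
      ((MultilinearMap.mkPiAlgebra ℝ (Fin 2) ℝ).compLinearMap
        ![Module.Dual.eval ℝ V v, Module.Dual.eval ℝ V w]).domDomCongr
          (Equiv.Perm.decomposeFin.symm p) ![a, b]) (by intro x; simp)]
  rw [Fintype.sum_prod_type, Fin.sum_univ_two]
  simp [Fin.prod_univ_two]
  try ring

theorem cont_two (v : V) {Ω : ExteriorAlgebra ℝ (Module.Dual ℝ V)}
    (hΩ : Ω ∈ ⋀[ℝ]^2 (Module.Dual ℝ V)) :
    ∃ c : Module.Dual ℝ V, cont v Ω = ExteriorAlgebra.ι ℝ c ∧ ∀ w, c w = asBilinForm Ω v w := by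
  have hadd : ∀ x y : ExteriorAlgebra ℝ (Module.Dual ℝ V),
      (∃ c : Module.Dual ℝ V, cont v x = ExteriorAlgebra.ι ℝ c ∧ ∀ w, c w = asBilinForm x v w) →
      (∃ c : Module.Dual ℝ V, cont v y = ExteriorAlgebra.ι ℝ c ∧ ∀ w, c w = asBilinForm y v w) →
      (∃ c : Module.Dual ℝ V, cont v (x + y) = ExteriorAlgebra.ι ℝ c ∧
        ∀ w, c w = asBilinForm (x + y) v w) := by
    rintro x y ⟨c, hc, hc'⟩ ⟨d, hd, hd'⟩
    refine ⟨c + d, by rw [map_add, map_add, hc, hd], fun w => ?_⟩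
    rw [asBilinForm_add, LinearMap.add_apply, hc', hd']
  refine power_induction (k := 1) ?_ hadd hΩ
  intro a y hy
  refine power_induction (k := 0) (p := fun y => ∃ c : Module.Dual ℝ V,
    cont v (ExteriorAlgebra.ι ℝ a * y) = ExteriorAlgebra.ι ℝ c ∧
      ∀ w, c w = asBilinForm (ExteriorAlgebra.ι ℝ a * y) v w) ?_ ?_ hy
  · intro b z hz
    obtain ⟨r, rfl⟩ := mem_power_zero hz
    refine ⟨r • (a v • b - b v • a), ?_, fun w => ?_⟩
    · rw [← Algebra.commutes, ← Algebra.smul_def, mul_smul_comm, map_smul, cont_ι_mul, cont_ι,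
        ← Algebra.commutes, ← Algebra.smul_def]
      simp only [map_smul, map_sub]
    · rw [← Algebra.commutes, ← Algebra.smul_def, mul_smul_comm, asBilinForm_smul, asBilinForm_ι_ι]
      simp
  · intro y z hy hz
    rw [mul_add]
    exact hadd _ _ hy hz

/-- The `sl₂` argument. -/
theorem sl2_aux (m : ℕ) (L T : ExteriorAlgebra ℝ (Module.Dual ℝ V) →ₗ[ℝ]
      ExteriorAlgebra ℝ (Module.Dual ℝ V))
    (hcomm : ∀ k : ℕ, ∀ x ∈ ⋀[ℝ]^k (Module.Dual ℝ V), T (L x) = L (T x) + ((m : ℝ) - k) • x)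
    (h0 : ∀ x ∈ ⋀[ℝ]^0 (Module.Dual ℝ V), T x = 0)
    (h1 : ∀ x ∈ ⋀[ℝ]^1 (Module.Dual ℝ V), T x = 0)
    (h2 : ∀ k : ℕ, ∀ x ∈ ⋀[ℝ]^(k + 2) (Module.Dual ℝ V), T x ∈ ⋀[ℝ]^k (Module.Dual ℝ V))
    (k : ℕ) : ∀ (x : ExteriorAlgebra ℝ (Module.Dual ℝ V)) (a : ℝ),
      x ∈ ⋀[ℝ]^k (Module.Dual ℝ V) → k < m → 0 ≤ a → T (L x) = - (a • x) → x = 0 := by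
  have key : ∀ (k : ℕ) (x : ExteriorAlgebra ℝ (Module.Dual ℝ V)) (a : ℝ),
      x ∈ ⋀[ℝ]^k (Module.Dual ℝ V) → k < m → 0 ≤ a → T (L x) = - (a • x) → T x = 0 → x = 0 := by
    intro k x a hx hk ha h hT
    rw [hcomm k x hx, hT, map_zero, zero_add] at h
    have h' : ((m : ℝ) - k + a) • x = 0 := by rw [add_smul, h]; simp
    have hk' : (k : ℝ) < m := by exact_mod_cast hk
    exact (smul_eq_zero.1 h').resolve_left (by linarith)
  induction k using Nat.strong_induction_on with
  | _ k ih =>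
    intro x a hx hk ha h
    refine key k x a hx hk ha h ?_
    match k, ih, hx, hk with
    | 0, _, hx, _ => exact h0 x hx
    | 1, _, hx, _ => exact h1 x hx
    | k + 2, ih, hx, hk =>
      have hk' : ((k + 2 : ℕ) : ℝ) < m := by exact_mod_cast hk
      refine ih k (by omega) (T x) (a + (m - (k + 2 : ℕ))) (h2 k x hx) (by omega)
        (by linarith) ?_
      have h3 := hcomm _ x hx
      rw [h] at h3
      have h4 : L (T x) = - ((a + (m - (k + 2 : ℕ))) • x) := by
        rw [← sub_eq_iff_eq_add] at h3
        rw [← h3]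
        module
      rw [h4, map_neg, map_smul]

end helpers

theorem wedge_mul_injective_of_le {V : Type*} [AddCommGroup V] [Module ℝ V]
    [FiniteDimensional ℝ V] (m : ℕ) (hm : 1 ≤ m)
    (hdim : Module.finrank ℝ V = 2 * m)
    (ω : V →ₗ[ℝ] V →ₗ[ℝ] ℝ)
    (halt : ∀ v : V, ω v v = 0)
    (hnondeg : ∀ v : V, (∀ w : V, ω v w = 0) → v = 0)
    (Ω : ⋀[ℝ]^2 (Module.Dual ℝ V))
    (hΩ : ∀ v w : V, asBilinForm (Ω : ExteriorAlgebra ℝ (Module.Dual ℝ V)) v w = ω v w)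
    (k : ℕ) (hk : k ≤ m - 1) :
    Function.Injective (fun α : ⋀[ℝ]^k (Module.Dual ℝ V) =>
      (Ω : ExteriorAlgebra ℝ (Module.Dual ℝ V)) * (α : ExteriorAlgebra ℝ (Module.Dual ℝ V))) := by
  classical
  obtain ⟨Ω, hmem⟩ := Ω
  simp only at hΩ ⊢
  have hskew : ∀ v w, ω v w = - ω w v := by
    intro v w
    have h := halt (v + w)
    simp only [map_add, LinearMap.add_apply, halt] at h
    linarith
  have hinj : Function.Injective ω := by
    rw [injective_iff_map_eq_zero]
    intro v hv
    exact hnondeg v fun w => by rw [hv]; rfl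
  have hsurj : Function.Surjective ω :=
    (LinearMap.injective_iff_surjective_of_finrank_eq_finrank
      (Subspace.dual_finrank_eq (K := ℝ) (V := V)).symm).1 hinj
  have hcΩ : ∀ v, cont v Ω = ExteriorAlgebra.ι ℝ (ω v) := by
    intro v
    obtain ⟨c, hc, hc'⟩ := cont_two v hmem
    have : c = ω v := LinearMap.ext fun w => by rw [hc', hΩ]
    rw [hc, this]
  let b := Module.finBasis ℝ V
  choose f hf using fun i => hsurj (b.coord i)
  have he1 := euler (fun i => b.coord i) (fun i => b i) (fun a => b.sum_dual_apply_smul_coord a)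
  have he2 := euler (fun i => - ω (b i)) f (by
    intro a
    obtain ⟨u, rfl⟩ := hsurj a
    have : ∀ i, ω u (f i) • - ω (b i) = ω (b.repr u i • b i) := by
      intro i
      rw [hskew, hf, map_smul, Module.Basis.coord_apply]
      module
    simp_rw [this]
    rw [← map_sum, b.sum_repr])
  let L : ExteriorAlgebra ℝ (Module.Dual ℝ V) →ₗ[ℝ] ExteriorAlgebra ℝ (Module.Dual ℝ V) :=
    LinearMap.mulLeft ℝ Ω
  let T : ExteriorAlgebra ℝ (Module.Dual ℝ V) →ₗ[ℝ] ExteriorAlgebra ℝ (Module.Dual ℝ V) :=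
    (-(1 / 2) : ℝ) • ∑ i, (cont (f i)) ∘ₗ (cont (b i))
  have hL : ∀ x, L x = Ω * x := fun x => rfl
  have hT : ∀ x, T x = (-(1 / 2) : ℝ) • ∑ i, cont (f i) (cont (b i) x) := by
    intro x
    simp [T]
  have hcomm : ∀ k : ℕ, ∀ x ∈ ⋀[ℝ]^k (Module.Dual ℝ V),
      T (L x) = L (T x) + ((m : ℝ) - k) • x := by
    intro k x hx
    have h1 : ∀ i, cont (f i) (cont (b i) (Ω * x)) = Ω * cont (f i) (cont (b i) x) +
        ExteriorAlgebra.ι ℝ (b.coord i) * cont (b i) x +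
        ExteriorAlgebra.ι ℝ (- ω (b i)) * cont (f i) x - x := by
      intro i
      have h2 : ω (b i) (f i) = -1 := by
        rw [hskew, hf]
        simp
      rw [cont_two_mul _ hmem, map_add, cont_two_mul _ hmem, hcΩ, hcΩ, cont_ι_mul, h2, hf, map_neg,
        neg_mul]
      module
    rw [hT, hT, hL, hL]
    simp_rw [h1]
    rw [Finset.sum_sub_distrib, Finset.sum_add_distrib, Finset.sum_add_distrib, he1 k x hx,
      he2 k x hx, ← Finset.mul_sum, mul_smul_comm, Finset.sum_const, Finset.card_univ,
      Fintype.card_fin, ← Nat.cast_smul_eq_nsmul ℝ]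
    have hd : (Module.finrank ℝ V : ℝ) = 2 * m := by rw [hdim]; push_cast; rfl
    generalize Ω * ∑ i, cont (f i) (cont (b i) x) = S
    rw [hd]
    module
  intro α β hαβ
  have hsub : (α : ExteriorAlgebra ℝ (Module.Dual ℝ V)) - β = 0 := by
    refine sl2_aux m L T hcomm ?_ ?_ ?_ k _ 0 (Submodule.sub_mem _ α.2 β.2) (by omega) le_rfl ?_
    · intro x hx
      rw [hT]
      simp [cont_zero hx]
    · intro x hx
      rw [hT]
      simp [fun i => cont_zero (cont_mem (b i) 0 x hx)]
    · intro k x hx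
      rw [hT]
      exact Submodule.smul_mem _ _ (Submodule.sum_mem _ fun i _ =>
        cont_mem _ _ _ (cont_mem _ _ _ hx))
    · have h0 : L ((α : ExteriorAlgebra ℝ (Module.Dual ℝ V)) - β) = 0 := by
        rw [hL, mul_sub, sub_eq_zero]
        exact hαβ
      rw [h0]
      simp
  exact Subtype.ext (sub_eq_zero.1 hsub)
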